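/- Let (X,d) be a complete, locally compact CAT(0) space with the geodesic extension property. If C, D ⊆ X are nonempty, convex, closed, and disjoint and at least one of them is bounded, then there exist x ∈ C and ([γ],1), ([η],1) ∈ T_x X opposite to each other such that sup{⟨([γ],1),([γ^y],d(x,y))⟩ : y ∈ D} < 0 and sup{⟨([η],1),([γ^y],d(x,y))⟩ : y ∈ C} ≤ 0, where γ^y denotes the geodesic from x to y. -/

import Mathlib

/-!
Basic convex analysis in metric spaces with bounded curvature:
common definitions (geodesics, Alexandrov angles, tangent-space elements,
normal cones, subdifferentials, CAT(κ) conditions).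
-/

open Metric Real Set Filter

noncomputable section

namespace CATPaper

/-- A geodesic of length `l` in a metric space `X`: a map `ℝ → X` that is isometric
on `[0, l]` (values outside `[0, l]` are irrelevant). -/
structure Geodesic (X : Type*) [MetricSpace X] where
  l : ℝ
  l_nonneg : 0 ≤ l
  map : ℝ → X
  isom : ∀ s ∈ Set.Icc (0:ℝ) l, ∀ t ∈ Set.Icc (0:ℝ) l, dist (map s) (map t) = |s - t|

variable {X : Type*} [MetricSpace X]

/-- The constant geodesic at a point. -/
def constGeod (x : X) : Geodesic X :=
  ⟨0, le_rfl, fun _ => x, by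
    rintro s ⟨hs0, hs1⟩ t ⟨ht0, ht1⟩
    have : s = t := by nlinarith
    simp [this]⟩

/-- `γ` is a geodesic from `x` to `y` (parametrized by arclength on `[0, d(x,y)]`). -/
def GeodesicFromTo (γ : Geodesic X) (x y : X) : Prop :=
  γ.map 0 = x ∧ γ.l = dist x y ∧ γ.map γ.l = y

/-- Every two points of `X` are joined by a geodesic. -/
def GeodesicSpace (X : Type*) [MetricSpace X] : Prop :=
  ∀ x y : X, ∃ γ : Geodesic X, GeodesicFromTo γ x y

/-- Every two points of `X` are joined by a unique geodesic segment. -/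
def UniquelyGeodesic (X : Type*) [MetricSpace X] : Prop :=
  ∀ (x y : X) (γ η : Geodesic X), GeodesicFromTo γ x y → GeodesicFromTo η x y →
    ∀ t ∈ Set.Icc (0:ℝ) (dist x y), γ.map t = η.map t

/-- The geodesic extension property around `x` with constant `R`: any geodesic between
distinct points `y, z ∈ B(x,R)` with `d(y,z) < R` extends beyond `z` to a geodesic of
length `R`. -/
def GeodExtAround (x : X) (R : ℝ) : Prop :=
  ∀ y z : X, y ∈ Metric.ball x R → z ∈ Metric.ball x R → y ≠ z → dist y z < R →
    ∃ γ : Geodesic X, γ.l = R ∧ γ.map 0 = y ∧ γ.map (dist y z) = z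

/-- The (global) geodesic extension property: every nondegenerate geodesic segment is
contained in a geodesic line. -/
def GeodExtGlobal (X : Type*) [MetricSpace X] : Prop :=
  ∀ γ : Geodesic X, 0 < γ.l → ∃ g : ℝ → X,
    (∀ s t : ℝ, dist (g s) (g t) = |s - t|) ∧ ∀ t ∈ Set.Icc (0:ℝ) γ.l, g t = γ.map t

/-- The Euclidean comparison angle at the vertex `x` of the triple `(p, x, q)`. -/
def compAngle (x p q : X) : ℝ :=
  Real.arccos ((dist x p ^ 2 + dist x q ^ 2 - dist p q ^ 2) / (2 * dist x p * dist x q))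

/-- The Alexandrov angle between two geodesics issuing at the same point: the limit as
`s, t ↘ 0` of the Euclidean comparison angles (junk value if the limit does not exist). -/
def alexAngle (γ η : Geodesic X) : ℝ :=
  limUnder ((nhdsWithin (0:ℝ) (Set.Ioi 0)) ×ˢ (nhdsWithin (0:ℝ) (Set.Ioi 0)))
    (fun p : ℝ × ℝ => compAngle (γ.map 0) (γ.map p.1) (η.map p.2))

/-- `([γ], r)` is an element of the tangent space at `x`: `γ` issues at `x`, `r ≥ 0`, and
`γ` is nonconstant unless `r = 0` (in which case `([γ], r)` is the origin `o_x`). -/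
def InTangent (x : X) (γ : Geodesic X) (r : ℝ) : Prop :=
  γ.map 0 = x ∧ 0 ≤ r ∧ (r = 0 ∨ 0 < γ.l)

/-- Equality of directions `[γ] = [η]` (equivalence classes under zero Alexandrov angle;
constant geodesics all represent the degenerate direction). -/
def DirEq (γ η : Geodesic X) : Prop :=
  (γ.l = 0 ∧ η.l = 0) ∨ (0 < γ.l ∧ 0 < η.l ∧ alexAngle γ η = 0)

/-- The scalar product `⟨([γ], r), ([η], s)⟩ = r·s·cos ∠(γ, η)` of two tangent-space
elements. -/
def tInner (γ : Geodesic X) (r : ℝ) (η : Geodesic X) (s : ℝ) : ℝ :=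
  r * s * Real.cos (alexAngle γ η)

/-- The tangent-space elements `([γ], r)` and `([η], s)` are opposite to each other. -/
def TanOpposite (γ : Geodesic X) (r : ℝ) (η : Geodesic X) (s : ℝ) : Prop :=
  (r = 0 ∧ s = 0) ∨ (r = s ∧ 0 < r ∧ alexAngle γ η = π)

/-- The metric projection of `z` onto `C`: the set of points of `C` nearest to `z`. -/
def projSet (C : Set X) (z : X) : Set X :=
  {y ∈ C | ∀ c ∈ C, dist z y ≤ dist z c}

/-- A set is convex if it contains every geodesic segment between its points. -/
def GConvex (C : Set X) : Prop :=
  ∀ γ : Geodesic X, γ.map 0 ∈ C → γ.map γ.l ∈ C → ∀ t ∈ Set.Icc (0:ℝ) γ.l, γ.map t ∈ C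

/-- `([γ], r)` belongs to the normal cone of `C` at `x`: `r = 0`, or `x` is the metric
projection onto `C` of `γ(t)` for some `t > 0`. -/
def InNormalCone (C : Set X) (x : X) (γ : Geodesic X) (r : ℝ) : Prop :=
  r = 0 ∨ ∃ t : ℝ, 0 < t ∧ t ≤ γ.l ∧ projSet C (γ.map t) = {x}

/-- The diameter `D_κ = π/√κ` of the model space `M_κ²` for `κ > 0`. -/
def Dk (κ : ℝ) : ℝ := π / Real.sqrt κ

/-- The comparison distance in the model sphere `M_κ²` of curvature `κ > 0`: the distance
from the vertex `p̄` to the point at arclength `t` along the side `q̄ r̄` of a comparison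
triangle with `d(q,r) = a`, `d(p,q) = b`, `d(p,r) = c`, computed via the spherical law of
cosines. -/
def modelCompDist (κ a b c t : ℝ) : ℝ :=
  (1 / Real.sqrt κ) * Real.arccos
    (Real.cos (Real.sqrt κ * b) * Real.cos (Real.sqrt κ * t) +
      Real.sin (Real.sqrt κ * b) * Real.sin (Real.sqrt κ * t) *
        ((Real.cos (Real.sqrt κ * c) - Real.cos (Real.sqrt κ * a) * Real.cos (Real.sqrt κ * b)) /
          (Real.sin (Real.sqrt κ * a) * Real.sin (Real.sqrt κ * b))))

/-- `X` is a `CAT(κ)` space for `κ > 0`: every two points at distance `< D_κ` are joined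
by a geodesic, and every geodesic triangle of perimeter `< 2 D_κ` is no thicker than its
comparison triangle in the model sphere `M_κ²`. -/
def IsCATK (κ : ℝ) (X : Type*) [MetricSpace X] : Prop :=
  (∀ x y : X, dist x y < Dk κ → ∃ γ : Geodesic X, GeodesicFromTo γ x y) ∧
  (∀ (p : X) (σ : Geodesic X),
    dist p (σ.map 0) + dist p (σ.map σ.l) + σ.l < 2 * Dk κ →
    ∀ t ∈ Set.Icc (0:ℝ) σ.l,
      dist p (σ.map t) ≤ modelCompDist κ σ.l (dist p (σ.map 0)) (dist p (σ.map σ.l)) t)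

/-- `X` is a `CAT(0)` space: a geodesic space satisfying the `CAT(0)` comparison
inequality `d(z, γ(t·l))² ≤ (1-t)·d(z,γ(0))² + t·d(z,γ(l))² - t(1-t)·l²`. -/
def IsCAT0 (X : Type*) [MetricSpace X] : Prop :=
  GeodesicSpace X ∧
  ∀ (z : X) (γ : Geodesic X), ∀ t ∈ Set.Icc (0:ℝ) 1,
    dist z (γ.map (t * γ.l)) ^ 2 ≤
      (1 - t) * dist z (γ.map 0) ^ 2 + t * dist z (γ.map γ.l) ^ 2 - t * (1 - t) * γ.l ^ 2

/-- The standing assumptions of the paper: `(X,d)` is a locally compact, uniquely geodesic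
`CAT(κ)` space (`κ > 0`) having, around every point `x`, the geodesic extension property
with a constant `R x < D_κ/2`. -/
structure Standing (κ : ℝ) (X : Type*) [MetricSpace X] (R : X → ℝ) : Prop where
  kpos : 0 < κ
  locComp : LocallyCompactSpace X
  cat : IsCATK κ X
  geod : GeodesicSpace X
  unique : UniquelyGeodesic X
  Rpos : ∀ x : X, 0 < R x
  Rsmall : ∀ x : X, R x < Dk κ / 2
  ext : ∀ x : X, GeodExtAround x (R x)

/-- A function `f : X → (-∞, ∞]` is convex if
`f(γ(t·l)) ≤ (1-t)·f(γ(0)) + t·f(γ(l))` along every geodesic. -/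
def GConvexFn (f : X → EReal) : Prop :=
  ∀ (γ : Geodesic X), ∀ t ∈ Set.Icc (0:ℝ) 1,
    f (γ.map (t * γ.l)) ≤ ((1 - t : ℝ) : EReal) * f (γ.map 0) + (t : EReal) * f (γ.map γ.l)

/-- The product `X × ℝ` equipped with the metric
`d₂((x₁,λ₁),(x₂,λ₂)) = √(d(x₁,x₂)² + |λ₁-λ₂|²)`. -/
abbrev XR (X : Type*) [MetricSpace X] : Type _ := WithLp 2 (X × ℝ)

/-- The point `(x, a)` of `X × ℝ`. -/
def toXR (x : X) (a : ℝ) : XR X := (WithLp.equiv 2 (X × ℝ)).symm (x, a)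

/-- The epigraph of `f : X → (-∞, ∞]`, as a subset of `X × ℝ`. -/
def epigraph (f : X → EReal) : Set (XR X) :=
  {p : XR X | f ((WithLp.equiv 2 (X × ℝ)) p).1 ≤ ((((WithLp.equiv 2 (X × ℝ)) p).2 : ℝ) : EReal)}

/-- `([γ], r) ∈ ∂f(x)`: the geodesic `σ(t) = (γ(rt/√(r²+1)), f(x) - t/√(r²+1))`,
`t ∈ [0, R₀]`, in `X × ℝ` satisfies `([σ], 1) ∈ N_{epi f}(x, f(x))`. -/
def IsSubgrad (R₀ : ℝ) (f : X → EReal) (x : X) (γ : Geodesic X) (r : ℝ) : Prop :=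
  ∃ σ : Geodesic (XR X), σ.l = R₀ ∧
    (∀ t : ℝ, σ.map t =
      toXR (γ.map (r * t / Real.sqrt (r ^ 2 + 1)))
        ((f x).toReal - t / Real.sqrt (r ^ 2 + 1))) ∧
    InNormalCone (epigraph f) (toXR x (f x).toReal) σ 1

/-- `([γ], r) ∈ ∂f(x)` in the `CAT(0)` setting, where the defining geodesic `σ` may be
taken on any interval `[0, l]`, `l > 0`. -/
def IsSubgrad0 (f : X → EReal) (x : X) (γ : Geodesic X) (r : ℝ) : Prop :=
  ∃ σ : Geodesic (XR X), 0 < σ.l ∧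
    (∀ t : ℝ, σ.map t =
      toXR (γ.map (r * t / Real.sqrt (r ^ 2 + 1)))
        ((f x).toReal - t / Real.sqrt (r ^ 2 + 1))) ∧
    InNormalCone (epigraph f) (toXR x (f x).toReal) σ 1

end CATPaper

namespace CATPaper

open scoped Topology

/-- A nested sequence of nonempty closed sets in a complete metric space has a common point, if
a function that is bounded on the first set is uniformly midpoint-convex on each of them. -/
theorem exists_mem_all_of_midpoint_convex {E : Type*} [MetricSpace E] [CompleteSpace E]
    (S : ℕ → Set E) (hS : Antitone S) (hcl : ∀ n, IsClosed (S n)) (hne : ∀ n, (S n).Nonempty)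
    (φ : E → ℝ) (hφ : ∀ e, 0 ≤ φ e) (B : ℝ) (hB : ∀ e ∈ S 0, φ e ≤ B)
    (hmid : ∀ n, ∀ a ∈ S n, ∀ b ∈ S n, ∃ m ∈ S n,
      φ m ≤ (φ a + φ b) / 2 - dist a b ^ 2 / 4) :
    ∃ e, ∀ n, e ∈ S n := by
  set r : ℕ → ℝ := fun n => sInf (φ '' S n) with hr
  have hbdd : ∀ n, BddBelow (φ '' S n) := fun n => ⟨0, by rintro _ ⟨e, -, rfl⟩; exact hφ e⟩
  have hle : ∀ n, ∀ e ∈ S n, r n ≤ φ e := fun n e he => csInf_le (hbdd n) ⟨e, he, rfl⟩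
  have hrmono : Monotone r := fun n k hnk =>
    csInf_le_csInf (hbdd n) ((hne k).image φ) (image_mono (hS hnk))
  have hrB : BddAbove (range r) := by
    refine ⟨B, ?_⟩
    rintro _ ⟨n, rfl⟩
    obtain ⟨e, he⟩ := hne n
    exact (hle n e he).trans (hB e (hS (Nat.zero_le n) he))
  have hex : ∀ n : ℕ, ∃ e ∈ S n, φ e < r n + 1 / ((n : ℝ) + 1) := by
    intro n
    obtain ⟨_, ⟨e, he, rfl⟩, h⟩ := exists_lt_of_csInf_lt ((hne n).image φ)
      (lt_add_of_pos_right (r n) (Nat.one_div_pos_of_nat (n := n) (α := ℝ)))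
    exact ⟨e, he, h⟩
  choose a haS haφ using hex
  have hlim : Tendsto r atTop (𝓝 (⨆ n, r n)) := tendsto_atTop_ciSup hrmono hrB
  have hlim2 : Tendsto (fun n : ℕ => √(4 * ((⨆ n, r n) + 1 / ((n : ℝ) + 1) - r n)))
      atTop (𝓝 0) := by
    have := ((((tendsto_const_nhds (x := ⨆ n, r n)).add
      (tendsto_one_div_add_atTop_nhds_zero_nat (𝕜 := ℝ))).sub hlim).const_mul 4).sqrt
    simpa using this
  have hC : CauchySeq a := by
    refine cauchySeq_of_le_tendsto_0 _ (fun n k N hn hk => ?_) hlim2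
    obtain ⟨m, hm, hmφ⟩ := hmid N (a n) (hS hn (haS n)) (a k) (hS hk (haS k))
    have key : ∀ j, N ≤ j → φ (a j) ≤ (⨆ n, r n) + 1 / ((N : ℝ) + 1) := fun j hj =>
      (haφ j).le.trans (add_le_add (le_ciSup hrB j) (Nat.one_div_le_one_div hj))
    apply Real.le_sqrt_of_sq_le
    linarith [key n hn, key k hk, hle N m hm]
  obtain ⟨e, he⟩ := cauchySeq_tendsto_of_complete hC
  refine ⟨e, fun n => (hcl n).mem_of_tendsto he ?_⟩
  filter_upwards [eventually_ge_atTop n] with k hk using hS hk (haS k)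

section Geodesics

variable {X : Type*} [MetricSpace X]

theorem Geodesic.dist_zero (γ : Geodesic X) {s : ℝ} (h0 : 0 ≤ s) (hs : s ≤ γ.l) :
    dist (γ.map 0) (γ.map s) = s := by
  rw [γ.isom 0 ⟨le_rfl, γ.l_nonneg⟩ s ⟨h0, hs⟩, zero_sub, abs_neg, abs_of_nonneg h0]

/-- The initial piece of length `s` of a geodesic. -/
def Geodesic.restrict (γ : Geodesic X) (s : ℝ) (h0 : 0 ≤ s) (hs : s ≤ γ.l) : Geodesic X :=
  ⟨s, h0, γ.map, fun a ha b hb => γ.isom a ⟨ha.1, ha.2.trans hs⟩ b ⟨hb.1, hb.2.trans hs⟩⟩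

/-- The geodesic of length `l` along an isometric line, started at parameter `a`. -/
def lineGeodesic (g : ℝ → X) (hg : ∀ s t : ℝ, dist (g s) (g t) = |s - t|) (a l : ℝ)
    (hl : 0 ≤ l) : Geodesic X :=
  ⟨l, hl, fun t => g (a + t), fun s _ t _ => by rw [hg, add_sub_add_left_eq_sub]⟩

/-- The geodesic of length `l` running backwards along an isometric line from parameter `0`. -/
def lineGeodesicNeg (g : ℝ → X) (hg : ∀ s t : ℝ, dist (g s) (g t) = |s - t|) (l : ℝ)
    (hl : 0 ≤ l) : Geodesic X :=
  ⟨l, hl, fun t => g (-t), fun s _ t _ => by rw [hg, neg_sub_neg, abs_sub_comm]⟩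

theorem IsCAT0.dist_sq_le (hcat : IsCAT0 X) (γ : Geodesic X) (z : X) {s r : ℝ}
    (h0 : 0 ≤ s) (hs : s ≤ γ.l) (hr0 : 0 ≤ r) (hr1 : r ≤ 1) :
    dist z (γ.map (r * s)) ^ 2 ≤
      (1 - r) * dist z (γ.map 0) ^ 2 + r * dist z (γ.map s) ^ 2 - r * (1 - r) * s ^ 2 :=
  hcat.2 z (γ.restrict s h0 hs) r ⟨hr0, hr1⟩

theorem IsCAT0.exists_midpoint (hcat : IsCAT0 X) (a b : X) :
    ∃ m : X, (∀ C : Set X, GConvex C → a ∈ C → b ∈ C → m ∈ C) ∧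
      ∀ z, dist z m ^ 2 ≤ dist z a ^ 2 / 2 + dist z b ^ 2 / 2 - dist a b ^ 2 / 4 := by
  obtain ⟨γ, h0, hl, h1⟩ := hcat.1 a b
  refine ⟨γ.map (1 / 2 * γ.l), fun C hC ha hb => ?_, fun z => ?_⟩
  · exact hC γ (h0 ▸ ha) (h1 ▸ hb) _
      ⟨by linarith [γ.l_nonneg], by linarith [γ.l_nonneg]⟩
  · have := hcat.2 z γ (1 / 2) ⟨by norm_num, by norm_num⟩
    rw [h0, h1, hl] at this
    rw [hl]
    linarith

/-- Midpoints `m`, `m'` of two sides issuing at a common vertex `p` satisfy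
`d(m, m') ≤ d(b, c) / 2`. -/
theorem dist_midpoint_le_of_common_vertex {p b c m m' : X}
    (hm : ∀ z, dist z m ^ 2 ≤ dist z p ^ 2 / 2 + dist z b ^ 2 / 2 - dist p b ^ 2 / 4)
    (hm' : ∀ z, dist z m' ^ 2 ≤ dist z p ^ 2 / 2 + dist z c ^ 2 / 2 - dist p c ^ 2 / 4) :
    dist m m' ≤ dist b c / 2 := by
  have h1 := hm' m
  have h2 := hm p
  have h3 := hm c
  rw [dist_self] at h2
  rw [dist_comm m p, dist_comm m c] at h1
  rw [dist_comm c p, dist_comm c b] at h3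
  refine le_of_sq_le_sq ?_ (by positivity)
  nlinarith

theorem IsCAT0.dist_midpoint_le (hcat : IsCAT0 X) {a a' b b' m n : X}
    (hm : ∀ z, dist z m ^ 2 ≤ dist z a ^ 2 / 2 + dist z a' ^ 2 / 2 - dist a a' ^ 2 / 4)
    (hn : ∀ z, dist z n ^ 2 ≤ dist z b ^ 2 / 2 + dist z b' ^ 2 / 2 - dist b b' ^ 2 / 4) :
    dist m n ≤ (dist a b + dist a' b') / 2 := by
  obtain ⟨k, -, hk⟩ := hcat.exists_midpoint a b'
  have h1 : dist m k ≤ dist a' b' / 2 := dist_midpoint_le_of_common_vertex hm hk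
  have h2 : dist k n ≤ dist a b / 2 := by
    refine dist_midpoint_le_of_common_vertex (p := b') (fun z => ?_) (fun z => ?_)
    · rw [dist_comm b' a]; linarith [hk z]
    · rw [dist_comm b' b]; linarith [hn z]
  linarith [dist_triangle m k n]

/-- Two nonempty closed convex subsets of a complete `CAT(0)` space, one of which is bounded,
contain a pair of points at minimal distance. -/
theorem IsCAT0.exists_nearest_pair [CompleteSpace X] (hcat : IsCAT0 X) {C D : Set X}
    (hCne : C.Nonempty) (hDne : D.Nonempty) (hCconv : GConvex C) (hDconv : GConvex D)
    (hCcl : IsClosed C) (hDcl : IsClosed D)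
    (hbdd : Bornology.IsBounded C ∨ Bornology.IsBounded D) :
    ∃ x ∈ C, ∃ z ∈ D, ∀ a ∈ C, ∀ b ∈ D, dist x z ≤ dist a b := by
  obtain ⟨p, hp⟩ := hCne
  obtain ⟨q, hq⟩ := hDne
  set T : Set ℝ := (fun e : X × X => dist e.1 e.2) '' (C ×ˢ D)
  have hTne : T.Nonempty := ⟨_, (p, q), ⟨hp, hq⟩, rfl⟩
  have hTb : BddBelow T := ⟨0, by rintro _ ⟨e, -, rfl⟩; exact dist_nonneg⟩
  set S : ℕ → Set (X × X) :=
    fun n => (C ×ˢ D) ∩ {e | dist e.1 e.2 ≤ sInf T + 1 / ((n : ℝ) + 1)}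
  obtain ⟨K, hK⟩ : ∃ K, ∀ e ∈ S 0, dist p e.1 ≤ K ∧ dist q e.2 ≤ K := by
    rcases hbdd with h | h
    · obtain ⟨R, hR⟩ := h.subset_closedBall p
      refine ⟨R + (dist p q + R + (sInf T + 1 / (((0 : ℕ) : ℝ) + 1))), fun e he => ?_⟩
      have h1 : dist e.1 p ≤ R := hR he.1.1
      have h2 : dist e.1 e.2 ≤ sInf T + 1 / (((0 : ℕ) : ℝ) + 1) := he.2
      rw [dist_comm] at h1
      have h3 := dist_triangle4 q p e.1 e.2
      rw [dist_comm q p] at h3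
      have := dist_nonneg (x := p) (y := q)
      have := dist_nonneg (x := p) (y := e.1)
      have := dist_nonneg (x := e.1) (y := e.2)
      constructor <;> linarith
    · obtain ⟨R, hR⟩ := h.subset_closedBall q
      refine ⟨R + (dist p q + R + (sInf T + 1 / (((0 : ℕ) : ℝ) + 1))), fun e he => ?_⟩
      have h1 : dist e.2 q ≤ R := hR he.1.2
      have h2 : dist e.1 e.2 ≤ sInf T + 1 / (((0 : ℕ) : ℝ) + 1) := he.2
      rw [dist_comm] at h1
      have h3 := dist_triangle4 p q e.2 e.1
      rw [dist_comm e.2 e.1] at h3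
      have := dist_nonneg (x := p) (y := q)
      have := dist_nonneg (x := q) (y := e.2)
      have := dist_nonneg (x := e.1) (y := e.2)
      constructor <;> linarith
  obtain ⟨e, he⟩ := exists_mem_all_of_midpoint_convex S
    (fun n k hnk e he => ⟨he.1, by
      have h : dist e.1 e.2 ≤ _ := he.2
      exact h.trans (add_le_add le_rfl (Nat.one_div_le_one_div hnk))⟩)
    (fun n => (hCcl.prod hDcl).inter
      (isClosed_le (continuous_fst.dist continuous_snd) continuous_const))
    (fun n => by
      obtain ⟨_, ⟨e, he, rfl⟩, h⟩ := exists_lt_of_csInf_lt hTne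
        (lt_add_of_pos_right (sInf T) (Nat.one_div_pos_of_nat (n := n) (α := ℝ)))
      exact ⟨e, he, h.le⟩)
    (fun e => dist p e.1 ^ 2 + dist q e.2 ^ 2) (fun e => by positivity) (K ^ 2 + K ^ 2)
    (fun e he => add_le_add (pow_le_pow_left₀ dist_nonneg (hK e he).1 2)
      (pow_le_pow_left₀ dist_nonneg (hK e he).2 2))
    (fun n a ha b hb => by
      obtain ⟨m, hmC, hm⟩ := hcat.exists_midpoint a.1 b.1
      obtain ⟨k, hkD, hk⟩ := hcat.exists_midpoint a.2 b.2
      refine ⟨(m, k), ⟨⟨hmC C hCconv ha.1.1 hb.1.1, hkD D hDconv ha.1.2 hb.1.2⟩, ?_⟩, ?_⟩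
      · have h1 : dist m k ≤ _ := hcat.dist_midpoint_le hm hk
        have h2 : dist a.1 a.2 ≤ sInf T + 1 / ((n : ℝ) + 1) := ha.2
        have h3 : dist b.1 b.2 ≤ sInf T + 1 / ((n : ℝ) + 1) := hb.2
        change dist m k ≤ sInf T + 1 / ((n : ℝ) + 1)
        linarith
      · have h1 := hm p
        have h2 := hk q
        have h3 : dist a b ^ 2 ≤ dist a.1 b.1 ^ 2 + dist a.2 b.2 ^ 2 := by
          rw [Prod.dist_eq]
          rcases max_choice (dist a.1 b.1) (dist a.2 b.2) with h | h <;> rw [h] <;>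
            nlinarith [sq_nonneg (dist a.1 b.1), sq_nonneg (dist a.2 b.2)]
        change dist p m ^ 2 + dist q k ^ 2 ≤ _
        linarith)
  refine ⟨e.1, (he 0).1.1, e.2, (he 0).1.2, fun a ha b hb => ?_⟩
  have h1 : dist e.1 e.2 ≤ sInf T + 0 :=
    ge_of_tendsto' (tendsto_const_nhds.add (tendsto_one_div_add_atTop_nhds_zero_nat (𝕜 := ℝ)))
      fun n => (he n).2
  rw [add_zero] at h1
  exact h1.trans (csInf_le hTb ⟨(a, b), ⟨ha, hb⟩, rfl⟩)

/-- If `z` is a nearest point to `x` of a convex set, the angle at `z` is not acute. -/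
theorem IsCAT0.sq_add_sq_le_of_nearest (hcat : IsCAT0 X) {D : Set X} (hD : GConvex D)
    {x y z : X} (hz : z ∈ D) (hy : y ∈ D) (hmin : ∀ b ∈ D, dist x z ≤ dist x b) :
    dist x z ^ 2 + dist z y ^ 2 ≤ dist x y ^ 2 := by
  obtain ⟨γ, h0, hl, h1⟩ := hcat.1 z y
  have key : ∀ t ∈ Ioi (0 : ℝ), t ≤ 1 →
      dist x z ^ 2 + (1 - t) * dist z y ^ 2 ≤ dist x y ^ 2 := by
    intro t ht ht1
    have ht0 : 0 < t := ht
    have hmem : γ.map (t * γ.l) ∈ D := hD γ (h0 ▸ hz) (h1 ▸ hy) _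
      ⟨mul_nonneg ht0.le γ.l_nonneg, mul_le_of_le_one_left γ.l_nonneg ht1⟩
    have h2 := hcat.2 x γ t ⟨ht0.le, ht1⟩
    have h3 := pow_le_pow_left₀ dist_nonneg (hmin _ hmem) 2
    rw [h0, h1, hl] at h2
    rw [hl] at h3
    have h4 : t * (dist x z ^ 2 + (1 - t) * dist z y ^ 2) ≤ t * dist x y ^ 2 := by linarith
    exact le_of_mul_le_mul_left h4 ht0
  have hlim : Tendsto (fun t : ℝ => dist x z ^ 2 + (1 - t) * dist z y ^ 2) (𝓝[>] 0)
      (𝓝 (dist x z ^ 2 + (1 - 0) * dist z y ^ 2)) :=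
    ((by fun_prop : Continuous fun t : ℝ => dist x z ^ 2 + (1 - t) * dist z y ^ 2).tendsto
      0).mono_left nhdsWithin_le_nhds
  rw [sub_zero, one_mul] at hlim
  refine le_of_tendsto hlim ?_
  filter_upwards [self_mem_nhdsWithin, Ioc_mem_nhdsGT one_pos] with t ht ht'
  exact key t ht ht'.2

end Geodesics

section Angles

variable {X : Type*} [MetricSpace X]

/-- The cosine of the comparison angle of `γ s` and `η t` at the common origin. -/
def compCos (γ η : Geodesic X) (p : ℝ × ℝ) : ℝ :=
  (p.1 ^ 2 + p.2 ^ 2 - dist (γ.map p.1) (η.map p.2) ^ 2) / (2 * p.1 * p.2)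

theorem compCos_swap (γ η : Geodesic X) (s t : ℝ) :
    compCos γ η (s, t) = compCos η γ (t, s) := by
  simp only [compCos]
  rw [dist_comm, add_comm, mul_right_comm]

theorem compAngle_eq_arccos_compCos {γ η : Geodesic X} (h : γ.map 0 = η.map 0) {p : ℝ × ℝ}
    (h1 : p.1 ∈ Ioc 0 γ.l) (h2 : p.2 ∈ Ioc 0 η.l) :
    compAngle (γ.map 0) (γ.map p.1) (η.map p.2) = Real.arccos (compCos γ η p) := by
  rw [compAngle, γ.dist_zero h1.1.le h1.2, h, η.dist_zero h2.1.le h2.2, compCos]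

theorem abs_compCos_le_one {γ η : Geodesic X} (h : γ.map 0 = η.map 0) {p : ℝ × ℝ}
    (h1 : p.1 ∈ Ioc 0 γ.l) (h2 : p.2 ∈ Ioc 0 η.l) : |compCos γ η p| ≤ 1 := by
  obtain ⟨s, t⟩ := p
  simp only at h1 h2
  have hs := γ.dist_zero h1.1.le h1.2
  have ht := η.dist_zero h2.1.le h2.2
  rw [← h] at ht
  have a1 := dist_triangle_left (γ.map s) (η.map t) (γ.map 0)
  have a2 := dist_triangle (γ.map 0) (γ.map s) (η.map t)
  have a3 := dist_triangle_right (γ.map 0) (γ.map s) (η.map t)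
  have hs0 := h1.1
  have ht0 := h2.1
  rw [hs, ht] at a1 a2 a3
  have a0 := dist_nonneg (x := γ.map s) (y := η.map t)
  rw [compCos, abs_le, le_div_iff₀ (by positivity), div_le_one (by positivity)]
  constructor <;> nlinarith

theorem IsCAT0.compCos_antitone_left (hcat : IsCAT0 X) {γ η : Geodesic X}
    (h : γ.map 0 = η.map 0) {s s' t : ℝ} (hs : 0 < s) (hss : s ≤ s') (hs' : s' ≤ γ.l)
    (ht : t ∈ Ioc 0 η.l) : compCos γ η (s', t) ≤ compCos γ η (s, t) := by
  have hs0 : 0 < s' := hs.trans_le hss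
  have ht0 := ht.1
  have key := hcat.dist_sq_le γ (η.map t) (s := s') (r := s / s') hs0.le hs' (by positivity)
    ((div_le_one hs0).2 hss)
  rw [div_mul_cancel₀ _ hs0.ne', h, dist_comm _ (η.map 0), η.dist_zero ht.1.le ht.2,
    dist_comm _ (γ.map s), dist_comm _ (γ.map s')] at key
  simp only [compCos]
  obtain ⟨r, rfl⟩ : ∃ r, s = r * s' := ⟨s / s', (div_mul_cancel₀ _ hs0.ne').symm⟩
  have hr : 0 < r := pos_of_mul_pos_left hs hs0.le
  rw [mul_div_cancel_right₀ _ hs0.ne'] at key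
  rw [div_le_div_iff₀ (by positivity) (by positivity)]
  have : 0 ≤ 2 * s' * t := by positivity
  nlinarith [mul_le_mul_of_nonneg_left key this]

theorem IsCAT0.compCos_antitone (hcat : IsCAT0 X) {γ η : Geodesic X} (h : γ.map 0 = η.map 0)
    {s s' t t' : ℝ} (hs : 0 < s) (hss : s ≤ s') (hs' : s' ≤ γ.l)
    (ht : 0 < t) (htt : t ≤ t') (ht' : t' ≤ η.l) :
    compCos γ η (s', t') ≤ compCos γ η (s, t) := by
  refine (hcat.compCos_antitone_left h hs hss hs' ⟨ht.trans_le htt, ht'⟩).trans ?_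
  rw [compCos_swap, compCos_swap γ η]
  exact hcat.compCos_antitone_left h.symm ht htt ht' ⟨hs, hss.trans hs'⟩

theorem eventually_mem_Ioc_prod {a b : ℝ} (ha : 0 < a) (hb : 0 < b) :
    ∀ᶠ p : ℝ × ℝ in 𝓝[>] 0 ×ˢ 𝓝[>] 0, p.1 ∈ Ioc 0 a ∧ p.2 ∈ Ioc 0 b :=
  prod_mem_prod (Ioc_mem_nhdsGT ha) (Ioc_mem_nhdsGT hb)

/-- In a `CAT(0)` space, the comparison angles converge to the Alexandrov angle. -/
theorem IsCAT0.tendsto_compCos (hcat : IsCAT0 X) {γ η : Geodesic X} (h : γ.map 0 = η.map 0)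
    (hγ : 0 < γ.l) (hη : 0 < η.l) :
    Tendsto (compCos γ η) (𝓝[>] 0 ×ˢ 𝓝[>] 0) (𝓝 (Real.cos (alexAngle γ η))) := by
  set S : Set ℝ := compCos γ η '' (Ioc 0 γ.l ×ˢ Ioc 0 η.l)
  have hSne : S.Nonempty := ⟨_, (γ.l, η.l), ⟨⟨hγ, le_rfl⟩, ⟨hη, le_rfl⟩⟩, rfl⟩
  have hSb : BddAbove S :=
    ⟨1, by rintro _ ⟨p, hp, rfl⟩; exact (abs_le.1 (abs_compCos_le_one h hp.1 hp.2)).2⟩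
  have hev := eventually_mem_Ioc_prod hγ hη
  have hlim : Tendsto (compCos γ η) (𝓝[>] 0 ×ˢ 𝓝[>] 0) (𝓝 (sSup S)) := by
    refine tendsto_order.2 ⟨fun a ha => ?_, fun a ha => ?_⟩
    · obtain ⟨_, ⟨q, hq, rfl⟩, hlt⟩ := exists_lt_of_lt_csSup hSne ha
      filter_upwards [eventually_mem_Ioc_prod hq.1.1 hq.2.1] with p hp
      exact hlt.trans_le
        (hcat.compCos_antitone h hp.1.1 hp.1.2 hq.1.2 hp.2.1 hp.2.2 hq.2.2)
    · filter_upwards [hev] with p hp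
      exact (le_csSup hSb ⟨p, hp, rfl⟩).trans_lt ha
  have hangle : alexAngle γ η = Real.arccos (sSup S) := by
    refine Tendsto.limUnder_eq (((Real.continuous_arccos.tendsto _).comp hlim).congr' ?_)
    filter_upwards [hev] with p hp
    exact (compAngle_eq_arccos_compCos h hp.1 hp.2).symm
  have h1 : -1 ≤ sSup S := ge_of_tendsto hlim (by
    filter_upwards [hev] with p hp using (abs_le.1 (abs_compCos_le_one h hp.1 hp.2)).1)
  have h2 : sSup S ≤ 1 := le_of_tendsto hlim (by
    filter_upwards [hev] with p hp using (abs_le.1 (abs_compCos_le_one h hp.1 hp.2)).2)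
  rwa [hangle, Real.cos_arccos h1 h2]

/-- Two geodesics that together form a geodesic line make an angle `π`. -/
theorem alexAngle_eq_pi_of_dist_eq_add {γ η : Geodesic X} (h : γ.map 0 = η.map 0)
    (hγ : 0 < γ.l) (hη : 0 < η.l)
    (hd : ∀ s ∈ Ioc 0 γ.l, ∀ t ∈ Ioc 0 η.l, dist (γ.map s) (η.map t) = s + t) :
    alexAngle γ η = π := by
  refine Tendsto.limUnder_eq (tendsto_const_nhds.congr' ?_)
  filter_upwards [eventually_mem_Ioc_prod hγ hη] with p hp
  have h1 := hp.1.1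
  have h2 := hp.2.1
  rw [compAngle_eq_arccos_compCos h hp.1 hp.2, compCos, hd _ hp.1 _ hp.2,
    ← Real.arccos_neg_one]
  congr 1
  field_simp
  ring

/-- If `γ` and `η` together form a geodesic line, the cosines of their angles with a third
geodesic have nonpositive sum. -/
theorem IsCAT0.cos_alexAngle_add_le (hcat : IsCAT0 X) {γ η ζ : Geodesic X}
    (g : ℝ → X) (hg : ∀ s t : ℝ, dist (g s) (g t) = |s - t|)
    (hγg : ∀ t ∈ Icc 0 γ.l, γ.map t = g (-t)) (hηg : ∀ t ∈ Icc 0 η.l, η.map t = g t)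
    (hζ0 : ζ.map 0 = g 0) (hγ : 0 < γ.l) (hη : 0 < η.l) (hζ : 0 < ζ.l) :
    Real.cos (alexAngle γ ζ) + Real.cos (alexAngle η ζ) ≤ 0 := by
  have hγ0 : γ.map 0 = ζ.map 0 := by rw [hγg 0 ⟨le_rfl, hγ.le⟩, neg_zero, hζ0]
  have hη0 : η.map 0 = ζ.map 0 := by rw [hηg 0 ⟨le_rfl, hη.le⟩, hζ0]
  refine le_of_tendsto ((hcat.tendsto_compCos hγ0 hγ hζ).add (hcat.tendsto_compCos hη0 hη hζ)) ?_
  filter_upwards [eventually_mem_Ioc_prod hγ hζ, eventually_mem_Ioc_prod hη hζ] with p hp hq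
  obtain ⟨s, t⟩ := p
  simp only at hp hq
  have hs := hp.1.1
  have ht := hp.2.1
  have key := hcat.2 (ζ.map t) (lineGeodesic g hg (-s) (2 * s) (by positivity)) (1 / 2)
    ⟨by norm_num, by norm_num⟩
  simp only [lineGeodesic] at key
  rw [show -s + 1 / 2 * (2 * s) = 0 by ring, show -s + 2 * s = s by ring, add_zero,
    ← hγg s ⟨hs.le, hp.1.2⟩, ← hηg s ⟨hs.le, hq.1.2⟩, ← hζ0, dist_comm _ (ζ.map 0),
    ζ.dist_zero ht.le hp.2.2, dist_comm _ (γ.map s), dist_comm _ (η.map s)] at key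
  simp only [compCos]
  rw [← add_div]
  exact div_nonpos_of_nonpos_of_nonneg (by linarith) (by positivity)

/-- The cosine law inequality for the Alexandrov angle. -/
theorem IsCAT0.sq_add_sq_sub_sq_le (hcat : IsCAT0 X) {γ η : Geodesic X}
    (h : γ.map 0 = η.map 0) (hγ : 0 < γ.l) (hη : 0 < η.l) :
    γ.l ^ 2 + η.l ^ 2 - dist (γ.map γ.l) (η.map η.l) ^ 2 ≤
      2 * γ.l * η.l * Real.cos (alexAngle γ η) := by
  have : compCos γ η (γ.l, η.l) ≤ Real.cos (alexAngle γ η) := by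
    refine ge_of_tendsto (hcat.tendsto_compCos h hγ hη) ?_
    filter_upwards [eventually_mem_Ioc_prod hγ hη] with p hp
    exact hcat.compCos_antitone h hp.1.1 hp.1.2 le_rfl hp.2.1 hp.2.2 le_rfl
  rw [compCos, div_le_iff₀ (by positivity)] at this
  linarith

/-- If the origin of `η` is at least as near to the endpoint of `η` as the points of `ζ` are, then
`η` and `ζ` do not make an acute angle. -/
theorem IsCAT0.cos_alexAngle_nonpos (hcat : IsCAT0 X) {η ζ : Geodesic X}
    (h : η.map 0 = ζ.map 0) (hη : 0 < η.l) (hζ : 0 < ζ.l)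
    (hmin : ∀ t ∈ Icc 0 ζ.l, η.l ≤ dist (ζ.map t) (η.map η.l)) :
    Real.cos (alexAngle η ζ) ≤ 0 := by
  have hid : Tendsto (fun s : ℝ => s) (𝓝[>] 0) (𝓝[>] 0) := tendsto_id
  have hsq : Tendsto (fun s : ℝ => s ^ 2) (𝓝[>] 0) (𝓝[>] 0) := by
    refine tendsto_nhdsWithin_iff.2 ⟨?_, ?_⟩
    · have := ((continuous_pow 2).tendsto (0 : ℝ)).mono_left
        (nhdsWithin_le_nhds (s := Ioi (0 : ℝ)))
      simpa using this
    · filter_upwards [self_mem_nhdsWithin] with s hs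
      exact pow_pos (mem_Ioi.1 hs) 2
  have hlim := (hcat.tendsto_compCos h hη hζ).comp (hid.prodMk hsq)
  have hhalf : Tendsto (fun s : ℝ => s / 2) (𝓝[>] 0) (𝓝 0) := by
    have := ((continuous_id.div_const 2).tendsto (0 : ℝ)).mono_left
      (nhdsWithin_le_nhds (s := Ioi (0 : ℝ)))
    simpa using this
  refine le_of_tendsto_of_tendsto hlim hhalf ?_
  filter_upwards [Ioc_mem_nhdsGT hη, hsq (Ioc_mem_nhdsGT hζ)] with s hs ht
  have hs0 := hs.1
  have ht' : s ^ 2 ∈ Ioc 0 ζ.l := ht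
  have h1 := hmin (s ^ 2) ⟨ht'.1.le, ht'.2⟩
  have h2 := dist_triangle_left (ζ.map (s ^ 2)) (η.map η.l) (η.map s)
  rw [η.isom s ⟨hs0.le, hs.2⟩ η.l ⟨hη.le, le_rfl⟩, abs_sub_comm,
    abs_of_nonneg (sub_nonneg.2 hs.2)] at h2
  have h3 : s ≤ dist (η.map s) (ζ.map (s ^ 2)) := by linarith
  have h4 := pow_le_pow_left₀ hs0.le h3 2
  simp only [Function.comp, compCos]
  rw [div_le_iff₀ (by positivity)]
  nlinarith

end Angles

/-- Corollary 4.21 (separation): in a complete, locally compact `CAT(0)` space with the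
geodesic extension property, if `C, D` are nonempty, convex, closed, disjoint and at
least one of them is bounded, then there exist `x ∈ C` and opposite tangent elements
`([γ],1), ([η],1) ∈ T_x X` with `sup_{y ∈ D} ⟨([γ],1),([γ^y],d(x,y))⟩ < 0` and
`sup_{y ∈ C} ⟨([η],1),([γ^y],d(x,y))⟩ ≤ 0`. -/
theorem statement19 {X : Type*} [MetricSpace X] [CompleteSpace X] [LocallyCompactSpace X]
    (hcat : IsCAT0 X) (hext : GeodExtGlobal X)
    (C D : Set X) (hCne : C.Nonempty) (hDne : D.Nonempty)
    (hCconv : GConvex C) (hDconv : GConvex D)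
    (hCcl : IsClosed C) (hDcl : IsClosed D) (hdisj : Disjoint C D)
    (hbdd : Bornology.IsBounded C ∨ Bornology.IsBounded D) :
    ∃ x ∈ C, ∃ γ η : Geodesic X,
      InTangent x γ 1 ∧ InTangent x η 1 ∧ TanOpposite γ 1 η 1 ∧
      (∃ c : ℝ, c < 0 ∧ ∀ y ∈ D, ∀ ζ : Geodesic X, GeodesicFromTo ζ x y →
        tInner γ 1 ζ (dist x y) ≤ c) ∧
      (∀ y ∈ C, ∀ ζ : Geodesic X, GeodesicFromTo ζ x y →
        tInner η 1 ζ (dist x y) ≤ 0) := by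
  obtain ⟨x, hx, z, hz, hmin⟩ :=
    hcat.exists_nearest_pair hCne hDne hCconv hDconv hCcl hDcl hbdd
  have hxz : 0 < dist x z := dist_pos.2 (hdisj.ne_of_mem hx hz)
  obtain ⟨η, hη0, hηl, hη1⟩ := hcat.1 x z
  have hη : 0 < η.l := hηl ▸ hxz
  obtain ⟨g, hg, hgη⟩ := hext η hη
  have hg0 : g 0 = x := by rw [hgη 0 ⟨le_rfl, hη.le⟩, hη0]
  set γ : Geodesic X := lineGeodesicNeg g hg 1 zero_le_one
  have hγ0 : γ.map 0 = x := by change g (-0) = x; rw [neg_zero, hg0]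
  have hγ : 0 < γ.l := one_pos
  refine ⟨x, hx, γ, η, ⟨hγ0, zero_le_one, Or.inr hγ⟩, ⟨hη0, zero_le_one, Or.inr hη⟩,
    Or.inr ⟨rfl, one_pos, ?_⟩, ⟨-dist x z, neg_lt_zero.2 hxz, ?_⟩, ?_⟩
  · refine alexAngle_eq_pi_of_dist_eq_add (hγ0.trans hη0.symm) hγ hη fun s hs t ht => ?_
    rw [← hgη t ⟨ht.1.le, ht.2⟩]
    change dist (g (-s)) (g t) = s + t
    rw [hg, abs_of_nonpos (by linarith [hs.1, ht.1])]
    ring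
  · rintro y hy ζ ⟨hζ0, hζl, hζ1⟩
    have hxy : 0 < dist x y := hxz.trans_le (hmin x hx y hy)
    have hζ : 0 < ζ.l := hζl ▸ hxy
    have h1 := hcat.cos_alexAngle_add_le (γ := γ) (η := η) (ζ := ζ) g hg (fun _ _ => rfl)
      (fun t ht => (hgη t ht).symm) (hζ0.trans hg0.symm) hγ hη hζ
    have h2 := hcat.sq_add_sq_sub_sq_le (hη0.trans hζ0.symm) hη hζ
    have h3 := hcat.sq_add_sq_le_of_nearest hDconv hz hy (hmin x hx)
    rw [hη1, hζ1, hηl, hζl] at h2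
    have h4 : dist x z * dist x z ≤
        dist x z * (dist x y * Real.cos (alexAngle η ζ)) := by nlinarith
    have h5 := le_of_mul_le_mul_left h4 hxz
    have h6 := mul_le_mul_of_nonneg_left h1 hxy.le
    rw [tInner]
    linarith
  · rintro y hy ζ ⟨hζ0, hζl, hζ1⟩
    rcases eq_or_lt_of_le (dist_nonneg (x := x) (y := y)) with h | h
    · rw [tInner, ← h]; simp
    · have hζ : 0 < ζ.l := hζl ▸ h
      have h1 := hcat.cos_alexAngle_nonpos (hη0.trans hζ0.symm) hη hζ fun t ht => by
        rw [hη1, hηl]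
        exact hmin _ (hCconv ζ (hζ0 ▸ hx) (hζ1 ▸ hy) t ht) z hz
      rw [tInner, one_mul]
      exact mul_nonpos_of_nonneg_of_nonpos h.le h1

end CATPaper
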